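/- Let (R,𝔪) be a commutative Noetherian local ring, 𝔞 an ideal of R, and M an arbitrary (not necessarily finitely generated) R-module. If r := grade(𝔞,M) is finite and r < depth M, then the local cohomology module H^r_𝔞(M) is not Artinian. -/

import Mathlib

/-!
STATEMENT 2: Let (R,𝔪) be a commutative Noetherian local ring, 𝔞 an ideal of R, and M an
arbitrary R-module. If r := grade(𝔞,M) is finite and r < depth M, then H^r_𝔞(M) is not
Artinian.

We encode `r = grade(𝔞,M) = inf{ i : Ext^i_R(R/𝔞, M) ≠ 0 }` by: `Ext^r_R(R/𝔞,M)` is nontrivial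
and `Ext^i_R(R/𝔞,M)` is trivial for `i < r`; and `r < depth M = inf{ i : Ext^i_R(R/𝔪,M) ≠ 0 }`
by: `Ext^i_R(R/𝔪,M)` is trivial for all `i ≤ r`.
-/

open CategoryTheory Opposite

universe u

namespace CategoryTheory.ProjectiveResolution

section ExtMk

variable {C : Type*} [Category* C] [Abelian C] [HasExt C]
  {X Y : C} (P : ProjectiveResolution X)

lemma extMk_zero_eq_zero_iff (f : P.complex.X 0 ⟶ Y) (hf : P.complex.d 1 0 ≫ f = 0) :
    P.extMk f 1 rfl hf = 0 ↔ f = 0 := by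
  refine ⟨fun h ↦ ?_, fun h ↦ by subst h; simp⟩
  rw [← P.extEquivCohomologyClass.apply_eq_iff_eq, extEquivCohomologyClass_extMk,
    extEquivCohomologyClass_zero, CochainComplex.HomComplex.CohomologyClass.mk_eq_zero_iff,
    CochainComplex.HomComplex.Cocycle.toSingleMk_mem_coboundaries_iff _ _ _ _ _ 1 (by simp)] at h
  obtain ⟨g, hg⟩ := h
  have h0 : Limits.IsZero (P.cochainComplex.X 1) :=
    HomologicalComplex.isZero_extend_X _ _ _ (by simp; intro n; lia)
  rw [h0.eq_of_src g 0, Limits.comp_zero] at hg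
  rw [← cancel_epi (P.cochainComplexXIso (-(0:ℕ)) 0 rfl).hom, ← hg, Limits.comp_zero]

lemma extMk_eq_zero_iff_next {n : ℕ} (f : P.complex.X n ⟶ Y)
    (hf : P.complex.d (n + 1) n ≫ f = 0) :
    P.extMk f (n + 1) rfl hf = 0 ↔
      ∃ g : P.complex.X ((ComplexShape.down ℕ).next n) ⟶ Y, P.complex.d n _ ≫ g = f := by
  cases n with
  | zero =>
    rw [extMk_zero_eq_zero_iff]
    simp [eq_comm]
  | succ p =>
    rw [P.extMk_eq_zero_iff f _ rfl hf p rfl, ChainComplex.next_nat_succ]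

end ExtMk

section LinearYoneda

variable {R : Type u} [CommRing R] {X X' : ModuleCat.{u} R} (P : ProjectiveResolution X)
  (P' : ProjectiveResolution X') (Y : ModuleCat.{u} R) (n : ℕ)

/-- The complex `Hom(P, Y)`, viewed as a chain complex in the opposite category of modules. -/
noncomputable abbrev opHomComplex : ChainComplex (ModuleCat.{u} R)ᵒᵖ ℕ :=
  (((linearYoneda R (ModuleCat.{u} R)).obj Y).rightOp.mapHomologicalComplex _).obj P.complex

/-- The module of `n`-cocycles of `Hom(P, Y)`. -/
noncomputable abbrev homCocycles : ModuleCat.{u} R := ((P.opHomComplex Y).opcycles n).unop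

/-- The morphism `P.complex.X n ⟶ Y` underlying an `n`-cocycle of `Hom(P, Y)`. -/
noncomputable def homCocyclesι : P.homCocycles Y n →ₗ[R] (P.complex.X n ⟶ Y) :=
  ((P.opHomComplex Y).pOpcycles n).unop.hom

/-- The class in `Ext` of an `n`-cocycle of `Hom(P, Y)`. -/
noncomputable def homCocyclesπ :
    P.homCocycles Y n →ₗ[R] ((Ext R (ModuleCat.{u} R) n).obj (op X)).obj Y :=
  ((P.isoLeftDerivedObj _ n).hom ≫ (P.opHomComplex Y).homologyι n).unop.hom

lemma homCocyclesπ_surjective : Function.Surjective (P.homCocyclesπ Y n) := by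
  have h₁ := (ModuleCat.epi_iff_surjective ((P.opHomComplex Y).homologyι n).unop).1 inferInstance
  have h₂ := (ModuleCat.epi_iff_surjective
    (P.isoLeftDerivedObj ((linearYoneda R (ModuleCat.{u} R)).obj Y).rightOp n).hom.unop).1
      inferInstance
  exact h₂.comp h₁

lemma d_comp_homCocyclesι (z : P.homCocycles Y n) :
    P.complex.d (n + 1) n ≫ P.homCocyclesι Y n z = 0 :=
  LinearMap.congr_fun (congrArg (fun f ↦ f.unop.hom)
    ((P.opHomComplex Y).d_pOpcycles (n + 1) n)) z

lemma exists_homCocyclesι_eq (f : P.complex.X n ⟶ Y) (hf : P.complex.d (n + 1) n ≫ f = 0) :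
    ∃ z, P.homCocyclesι Y n z = f := by
  have h := ((P.opHomComplex Y).opcyclesIsCokernel (n + 1) n (by simp))
  have h' := ShortComplex.exact_of_g_is_cokernel (ShortComplex.mk _ _
    ((P.opHomComplex Y).d_pOpcycles (n + 1) n)) h
  exact (ShortComplex.moduleCat_exact_iff _).1 h'.unop f hf

lemma homCocyclesι_injective : Function.Injective (P.homCocyclesι Y n) :=
  (ModuleCat.mono_iff_injective ((P.opHomComplex Y).pOpcycles n).unop).1 inferInstance

lemma homCocyclesπ_eq_zero_iff (z : P.homCocycles Y n) :
    P.homCocyclesπ Y n z = 0 ↔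
      ∃ g : P.complex.X ((ComplexShape.down ℕ).next n) ⟶ Y,
        P.complex.d n _ ≫ g = P.homCocyclesι Y n z := by
  have hfac (g : P.complex.X ((ComplexShape.down ℕ).next n) ⟶ Y) : P.homCocyclesι Y n
      (((P.opHomComplex Y).fromOpcycles n ((ComplexShape.down ℕ).next n)).unop.hom g) =
      P.complex.d n _ ≫ g :=
    LinearMap.congr_fun (congrArg (fun f ↦ f.unop.hom)
      ((P.opHomComplex Y).p_fromOpcycles n ((ComplexShape.down ℕ).next n))) g
  have hex := ShortComplex.exact_of_f_is_kernel (ShortComplex.mk _ _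
    ((P.opHomComplex Y).homologyι_comp_fromOpcycles n _))
    ((P.opHomComplex Y).homologyIsKernel n _ rfl)
  have hinj : Function.Injective (P.isoLeftDerivedObj
      ((linearYoneda R (ModuleCat.{u} R)).obj Y).rightOp n).hom.unop.hom :=
    (ModuleCat.mono_iff_injective
      (P.isoLeftDerivedObj ((linearYoneda R (ModuleCat.{u} R)).obj Y).rightOp n).hom.unop).1
      inferInstance
  have h1 : P.homCocyclesπ Y n z = 0 ↔ ((P.opHomComplex Y).homologyι n).unop.hom z = 0 :=
    map_eq_zero_iff (P.isoLeftDerivedObj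
      ((linearYoneda R (ModuleCat.{u} R)).obj Y).rightOp n).hom.unop.hom hinj
  rw [h1]
  constructor
  · intro h
    obtain ⟨g, hg⟩ := (ShortComplex.moduleCat_exact_iff _).1 hex.unop z h
    exact ⟨g, (hfac g).symm.trans (congrArg (P.homCocyclesι Y n) hg)⟩
  · rintro ⟨g, hg⟩
    rw [← hfac] at hg
    rw [← P.homCocyclesι_injective Y n hg]
    exact LinearMap.congr_fun (congrArg (fun f ↦ f.unop.hom)
      ((P.opHomComplex Y).homologyι_comp_fromOpcycles n _)) g

/-- The class in `Abelian.Ext` of an `n`-cocycle of `Hom(P, Y)`. -/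
noncomputable def homCocyclesToExt : P.homCocycles Y n →ₗ[R] Abelian.Ext X Y n where
  toFun z := P.extMk (P.homCocyclesι Y n z) (n + 1) rfl (P.d_comp_homCocyclesι Y n z)
  map_add' z z' := by
    rw [P.add_extMk]
    simp only [map_add]
  map_smul' r z := by
    rw [RingHom.id_apply, Abelian.Ext.smul_eq_comp_mk₀, P.extMk_comp_mk₀]
    simp only [map_smul, Linear.comp_smul, Category.comp_id]

lemma homCocyclesToExt_surjective : Function.Surjective (P.homCocyclesToExt Y n) := by
  intro α
  obtain ⟨f, hf, rfl⟩ := P.extMk_surjective α (n + 1) rfl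
  obtain ⟨z, rfl⟩ := P.exists_homCocyclesι_eq Y n f hf
  exact ⟨z, rfl⟩

lemma ker_homCocyclesπ : (P.homCocyclesπ Y n).ker = (P.homCocyclesToExt Y n).ker := by
  ext z
  rw [LinearMap.mem_ker, LinearMap.mem_ker, homCocyclesπ_eq_zero_iff]
  exact (P.extMk_eq_zero_iff_next _ (P.d_comp_homCocyclesι Y n z)).symm

/-- The comparison between the two definitions of `Ext` for modules, in terms of a projective
resolution of the first variable. -/
noncomputable def extLinearEquiv :
    ((Ext R (ModuleCat.{u} R) n).obj (op X)).obj Y ≃ₗ[R] Abelian.Ext X Y n :=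
  ((P.homCocyclesπ Y n).quotKerEquivOfSurjective (P.homCocyclesπ_surjective Y n)).symm ≪≫ₗ
    Submodule.quotEquivOfEq _ _ (P.ker_homCocyclesπ Y n) ≪≫ₗ
    (P.homCocyclesToExt Y n).quotKerEquivOfSurjective (P.homCocyclesToExt_surjective Y n)

lemma extLinearEquiv_homCocyclesπ (z : P.homCocycles Y n) :
    P.extLinearEquiv Y n (P.homCocyclesπ Y n z) = P.homCocyclesToExt Y n z := by
  have : ((P.homCocyclesπ Y n).quotKerEquivOfSurjective (P.homCocyclesπ_surjective Y n)).symm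
      (P.homCocyclesπ Y n z) = Submodule.Quotient.mk z := by
    rw [LinearEquiv.symm_apply_eq]
    rfl
  simp only [extLinearEquiv, LinearEquiv.trans_apply, this]
  rfl

lemma extLinearEquiv_naturality (g : X' ⟶ X)
    (x : ((Ext R (ModuleCat.{u} R) n).obj (op X)).obj Y) :
    P'.extLinearEquiv Y n ((((Ext R (ModuleCat.{u} R) n).map g.op).app Y).hom x) =
      (Abelian.Ext.mk₀ g).comp (P.extLinearEquiv Y n x) (zero_add n) := by
  obtain ⟨z, rfl⟩ := P.homCocyclesπ_surjective Y n x
  let φ : Hom P' P g := ⟨lift g P' P, lift_commutes_zero g P' P⟩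
  let ψ := (((linearYoneda R (ModuleCat.{u} R)).obj Y).rightOp.mapHomologicalComplex
    (ComplexShape.down ℕ)).map φ.hom
  let z' : P'.homCocycles Y n := (HomologicalComplex.opcyclesMap ψ n).unop.hom z
  have hι : P'.homCocyclesι Y n z' = φ.hom.f n ≫ P.homCocyclesι Y n z :=
    LinearMap.congr_fun (congrArg (fun f ↦ f.unop.hom)
      (HomologicalComplex.p_opcyclesMap ψ n)) z
  have hcomm := P'.isoLeftDerivedObj_hom_naturality g P φ.hom φ.hom_f_zero_comp_π_f_zero
    ((linearYoneda R (ModuleCat.{u} R)).obj Y).rightOp n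
  have hπ : ((((Ext R (ModuleCat.{u} R) n).map g.op).app Y).hom (P.homCocyclesπ Y n z)) =
      P'.homCocyclesπ Y n z' := by
    have h : (((linearYoneda R (ModuleCat.{u} R)).obj Y).rightOp.leftDerived n).map g ≫
        (P.isoLeftDerivedObj _ n).hom ≫ (P.opHomComplex Y).homologyι n =
        ((P'.isoLeftDerivedObj _ n).hom ≫ (P'.opHomComplex Y).homologyι n) ≫
          HomologicalComplex.opcyclesMap ψ n := by
      have hnat := HomologicalComplex.homologyι_naturality ψ n
      refine (Category.assoc _ _ _).symm.trans ?_
      refine (congrArg (· ≫ (P.opHomComplex Y).homologyι n) hcomm).trans ?_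
      refine (Category.assoc _ _ _).trans ?_
      exact (congrArg ((P'.isoLeftDerivedObj _ n).hom ≫ ·) hnat).trans (Category.assoc _ _ _).symm
    exact LinearMap.congr_fun (congrArg (fun f ↦ f.unop.hom) h) z
  rw [hπ, extLinearEquiv_homCocyclesπ, extLinearEquiv_homCocyclesπ]
  refine Eq.trans ?_ (mk₀_comp_extMk _ (n + 1) rfl (P.d_comp_homCocyclesι Y n z) φ).symm
  simp only [homCocyclesToExt, LinearMap.coe_mk, AddHom.coe_mk, hι]

end LinearYoneda

end CategoryTheory.ProjectiveResolution

namespace ModuleCat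

open Abelian

variable {R : Type u} [CommRing R]

section

variable {N N' : Type u} [AddCommGroup N] [Module R N] [AddCommGroup N'] [Module R N']
  (M : ModuleCat.{u} R)

lemma eq_zero_of_mk₀_comp_eq_zero (g : N →ₗ[R] N') (hg : Function.Surjective g) (i : ℕ)
    (h : ∀ j < i, Subsingleton (Ext (of R g.ker) M j))
    (x : Ext (of R N') M i) (hx : (Ext.mk₀ (ofHom g)).comp x (zero_add i) = 0) : x = 0 := by
  have : Epi (ofHom g) := (ModuleCat.epi_iff_surjective _).2 hg
  cases i with
  | zero =>
    exact Ext.precomp_mk₀_injective_of_epi M (ofHom g) (by simpa using hx)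
  | succ j =>
    have hS : (ShortComplex.mk (ofHom g.ker.subtype) (ofHom g) (by ext x; simp)).ShortExact :=
      { exact := (ShortComplex.ShortExact.moduleCat_exact_iff_function_exact _).2
          (LinearMap.exact_subtype_ker_map g)
        mono_f := (ModuleCat.mono_iff_injective _).2 g.ker.injective_subtype
        epi_g := this }
    obtain ⟨x₁, rfl⟩ := Ext.contravariant_sequence_exact₃ hS M x hx (add_comm 1 j)
    have := h j j.lt_succ_self
    rw [Subsingleton.elim x₁ 0, Ext.comp_zero]

lemma exists_mk₀_comp_eq (g : N →ₗ[R] N') (hg : Function.Surjective g) (i : ℕ)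
    (x : Ext (of R N) M i) (hx : (Ext.mk₀ (ofHom g.ker.subtype)).comp x (zero_add i) = 0) :
    ∃ y : Ext (of R N') M i, (Ext.mk₀ (ofHom g)).comp y (zero_add i) = x := by
  have hS : (ShortComplex.mk (ofHom g.ker.subtype) (ofHom g) (by ext x; simp)).ShortExact :=
    { exact := (ShortComplex.ShortExact.moduleCat_exact_iff_function_exact _).2
        (LinearMap.exact_subtype_ker_map g)
      mono_f := (ModuleCat.mono_iff_injective _).2 g.ker.injective_subtype
      epi_g := (ModuleCat.epi_iff_surjective _).2 hg }
  exact Ext.contravariant_sequence_exact₂ hS M x hx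

lemma subsingleton_ext_of_subsingleton [Subsingleton N] (i : ℕ) :
    Subsingleton (Ext (of R N) M i) := by
  refine subsingleton_of_forall_eq 0 fun x ↦ ?_
  rw [← Ext.mk₀_id_comp x, (ModuleCat.isZero_of_subsingleton (of R N)).eq_of_src (𝟙 _) 0,
    Ext.mk₀_zero, Ext.zero_comp]

lemma ext_pi_eq_zero {s : ℕ} {i : ℕ} (x : Ext (of R (Fin s → N)) M i)
    (hx : ∀ j, (Ext.mk₀ (ofHom (LinearMap.single R (fun _ : Fin s ↦ N) j))).comp x
      (zero_add i) = 0) : x = 0 := by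
  have hid : 𝟙 (of R (Fin s → N)) = ∑ j, ofHom (LinearMap.proj j) ≫
      ofHom (LinearMap.single R (fun _ : Fin s ↦ N) j) := by
    ext x k
    simp [ModuleCat.hom_sum, Pi.single_apply]
  rw [← Ext.mk₀_id_comp x, hid, Ext.mk₀_sum, Ext.sum_comp]
  refine Finset.sum_eq_zero fun j _ ↦ ?_
  rw [← Ext.mk₀_comp_mk₀, Ext.comp_assoc_of_second_deg_zero, hx, Ext.comp_zero]

end

variable {𝔞 : Ideal R} (M : ModuleCat.{u} R)

lemma exists_surjective_pi_quotient (N : Type u) [AddCommGroup N] [Module R N] [Module.Finite R N]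
    (hN : Module.IsTorsionBySet R N 𝔞) :
    ∃ (s : ℕ) (p : (Fin s → R ⧸ 𝔞) →ₗ[R] N), Function.Surjective p := by
  let := hN.module
  have : IsScalarTower R (R ⧸ 𝔞) N := hN.isScalarTower
  have : Module.Finite (R ⧸ 𝔞) N := Module.Finite.of_restrictScalars_finite R _ _
  obtain ⟨s, p, hp⟩ := Module.Finite.exists_fin' (R ⧸ 𝔞) N
  exact ⟨s, p.restrictScalars R, hp⟩

variable [IsNoetherianRing R]

lemma subsingleton_ext_of_isTorsionBySet {r : ℕ}
    (h : ∀ i < r, Subsingleton (Ext (of R (R ⧸ 𝔞)) M i)) (i : ℕ) (hi : i < r)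
    (N : Type u) [AddCommGroup N] [Module R N] [Module.Finite R N]
    (hN : Module.IsTorsionBySet R N 𝔞) :
    Subsingleton (Ext (of R N) M i) := by
  induction i using Nat.strong_induction_on generalizing N with
  | _ i ih =>
  obtain ⟨s, p, hp⟩ := exists_surjective_pi_quotient N hN
  refine subsingleton_of_forall_eq 0 fun x ↦
    eq_zero_of_mk₀_comp_eq_zero M p hp i (fun j hj ↦ ih j hj (hj.trans hi) _ ?_) x ?_
  · intro x a
    refine Subtype.ext (funext fun k ↦ ?_)
    obtain ⟨y, hy⟩ := Ideal.Quotient.mk_surjective (x.1 k)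
    change (a : R) • x.1 k = 0
    rw [← hy]
    exact Ideal.Quotient.eq_zero_iff_mem.2 (𝔞.mul_mem_right _ a.2)
  · have := h i hi
    exact ext_pi_eq_zero M _ fun j ↦ Subsingleton.elim _ _

lemma subsingleton_ext_of_isTorsionBySet_pow {r : ℕ}
    (h : ∀ i < r, Subsingleton (Ext (of R (R ⧸ 𝔞)) M i)) (i : ℕ) (hi : i < r) (n : ℕ)
    (N : Type u) [AddCommGroup N] [Module R N] [Module.Finite R N]
    (hN : Module.IsTorsionBySet R N (𝔞 ^ n : Ideal R)) :
    Subsingleton (Ext (of R N) M i) := by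
  induction n generalizing N with
  | zero =>
    have : Subsingleton N := subsingleton_of_forall_eq 0 fun x ↦ by
      simpa using @hN x ⟨1, by simp⟩
    exact subsingleton_ext_of_subsingleton M i
  | succ n ih =>
    let g := (𝔞 • (⊤ : Submodule R N)).mkQ
    have hg : Function.Surjective g := Submodule.mkQ_surjective _
    have h₁ : Subsingleton (Ext (of R g.ker) M i) := by
      refine ih _ fun x a ↦ Subtype.ext ?_
      have hx : x.1 ∈ 𝔞 • (⊤ : Submodule R N) :=
        (Submodule.Quotient.mk_eq_zero _).1 (LinearMap.mem_ker.1 x.2)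
      change (a : R) • x.1 = 0
      refine Submodule.smul_induction_on hx (fun b hb y _ ↦ ?_) fun y z hy hz ↦ by
        rw [smul_add, hy, hz, add_zero]
      rw [smul_smul]
      exact @hN y ⟨a * b, by rw [pow_succ]; exact Ideal.mul_mem_mul a.2 hb⟩
    have h₃ : Subsingleton (Ext (of R (N ⧸ 𝔞 • (⊤ : Submodule R N))) M i) := by
      refine subsingleton_ext_of_isTorsionBySet M h i hi _ fun x a ↦ ?_
      obtain ⟨y, rfl⟩ := hg x
      rw [← map_smul]
      exact (Submodule.Quotient.mk_eq_zero _).2 (Submodule.smul_mem_smul a.2 trivial)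
    refine subsingleton_of_forall_eq 0 fun x ↦ ?_
    obtain ⟨y, rfl⟩ := exists_mk₀_comp_eq M g hg i x (Subsingleton.elim _ _)
    rw [Subsingleton.elim y 0, Ext.comp_zero]

lemma eq_zero_of_mk₀_factor_comp_eq_zero {r : ℕ}
    (h : ∀ i < r, Subsingleton (Ext (of R (R ⧸ 𝔞)) M i)) {𝔟 : Ideal R} (n : ℕ)
    (hle : 𝔞 ^ n ≤ 𝔟) (g : (R ⧸ 𝔟) →ₗ[R] (R ⧸ 𝔞)) (hg : Function.Surjective g)
    (x : Ext (of R (R ⧸ 𝔞)) M r) (hx : (Ext.mk₀ (ofHom g)).comp x (zero_add r) = 0) : x = 0 := by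
  refine eq_zero_of_mk₀_comp_eq_zero M g hg r
    (fun j hj ↦ subsingleton_ext_of_isTorsionBySet_pow M h j hj n _ fun x a ↦ ?_) x hx
  obtain ⟨y, hy⟩ := Ideal.Quotient.mk_surjective x.1
  refine Subtype.ext ?_
  change (a : R) • x.1 = 0
  rw [← hy]
  exact Ideal.Quotient.eq_zero_iff_mem.2 (𝔟.mul_mem_right _ (hle a.2))

lemma ext_eq_zero_of_smul_eq_zero {r : ℕ} {𝔪 : Ideal R} (hle : 𝔞 ≤ 𝔪)
    (h : ∀ i < r, Subsingleton (Ext (of R (R ⧸ 𝔞)) M i))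
    (h𝔪 : Subsingleton (Ext (of R (R ⧸ 𝔪)) M r))
    (y : Ext (of R (R ⧸ 𝔞)) M r) (hy : ∀ c ∈ 𝔪, c • y = 0) : y = 0 := by
  let g : (R ⧸ 𝔞) →ₗ[R] (R ⧸ 𝔪) := Submodule.factor hle
  have hg : Function.Surjective g := Submodule.factor_surjective hle
  have htors {N : Type u} [AddCommGroup N] [Module R N] (hN : Module.IsTorsionBySet R N 𝔞)
      (K : Submodule R N) : Module.IsTorsionBySet R K 𝔞 :=
    fun x a ↦ Subtype.ext (@hN x.1 a)
  have hR : Module.IsTorsionBySet R (R ⧸ 𝔞) 𝔞 := fun x a ↦ by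
    obtain ⟨y, rfl⟩ := Ideal.Quotient.mk_surjective x
    exact Ideal.Quotient.eq_zero_iff_mem.2 (𝔞.mul_mem_right _ a.2)
  suffices h0 : (Ext.mk₀ (ofHom g.ker.subtype)).comp y (zero_add r) = 0 by
    obtain ⟨x, rfl⟩ := exists_mk₀_comp_eq M g hg r y h0
    rw [Subsingleton.elim x 0, Ext.comp_zero]
  obtain ⟨s, p, hp⟩ := exists_surjective_pi_quotient g.ker (htors hR _)
  refine eq_zero_of_mk₀_comp_eq_zero M p hp r (fun j hj ↦
    subsingleton_ext_of_isTorsionBySet M h j hj _ (htors ?_ _)) _ (ext_pi_eq_zero M _ fun j ↦ ?_)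
  · exact fun x a ↦ funext fun k ↦ @hR (x k) a
  · let q := g.ker.subtype ∘ₗ p ∘ₗ LinearMap.single R (fun _ : Fin s ↦ R ⧸ 𝔞) j
    obtain ⟨c, hc⟩ := Ideal.Quotient.mk_surjective (q 1)
    have hcm : c ∈ 𝔪 := by
      have : g (q 1) = 0 := (p (LinearMap.single R (fun _ : Fin s ↦ R ⧸ 𝔞) j 1)).2
      rw [← hc] at this
      exact Ideal.Quotient.eq_zero_iff_mem.1 this
    have hq : ofHom q = c • 𝟙 (of R (R ⧸ 𝔞)) := by
      refine ModuleCat.hom_ext (Submodule.linearMap_qext _ (LinearMap.ext_ring ?_))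
      change q 1 = c • (1 : R ⧸ 𝔞)
      rw [← hc, Algebra.smul_def, mul_one]
      rfl
    rw [Ext.mk₀_comp_mk₀_assoc, Ext.mk₀_comp_mk₀_assoc]
    change (Ext.mk₀ (ofHom q)).comp y _ = 0
    rw [hq, Ext.mk₀_smul, Ext.smul_comp, Ext.mk₀_id_comp, hy c hcm]

end ModuleCat

namespace localCohomology

variable {R : Type u} [CommRing R] (𝔞 : Ideal R) (i : ℕ) (M : ModuleCat.{u} R)

/-- The canonical map from `Ext^i(R/𝔞^n, M)` to the `i`-th local cohomology module of `M`. -/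
noncomputable def ofExt (n : ℕ) :
    ((Ext R (ModuleCat.{u} R) i).obj (op (ModuleCat.of R (R ⧸ 𝔞 ^ n)))).obj M ⟶
      (localCohomology 𝔞 i).obj M :=
  have := hasColimitDiagram.{u, 0} (idealPowersDiagram 𝔞) i
  (Limits.colimit.ι (diagram (idealPowersDiagram 𝔞) i) (op (op n))).app M

/-- The canonical surjection `R/𝔞^k → R/𝔞^n` for `n ≤ k`. -/
def quotientPowMap {n k : ℕ} (h : n ≤ k) : (R ⧸ 𝔞 ^ k) →ₗ[R] (R ⧸ 𝔞 ^ n) :=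
  Submodule.mapQ _ _ LinearMap.id (Ideal.pow_le_pow_right h)

lemma quotientPowMap_surjective {n k : ℕ} (h : n ≤ k) :
    Function.Surjective (quotientPowMap 𝔞 h) := fun x ↦ by
  obtain ⟨y, rfl⟩ := Submodule.Quotient.mk_surjective _ x
  exact ⟨Submodule.Quotient.mk y, rfl⟩

lemma exists_map_eq_zero_of_ofExt_eq_zero (n : ℕ)
    (x : ((Ext R (ModuleCat.{u} R) i).obj (op (ModuleCat.of R (R ⧸ 𝔞 ^ n)))).obj M)
    (hx : (ofExt 𝔞 i M n).hom x = 0) :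
    ∃ (k : ℕ) (h : n ≤ k), (((Ext R (ModuleCat.{u} R) i).map
      (ModuleCat.ofHom (quotientPowMap 𝔞 h)).op).app M).hom x = 0 := by
  have := hasColimitDiagram.{u, 0} (idealPowersDiagram 𝔞) i
  let F := diagram (idealPowersDiagram 𝔞) i
  let hc := Limits.isColimitOfPreserves ((evaluation (ModuleCat.{u} R) (ModuleCat.{u} R)).obj M)
    (Limits.colimit.isColimit F)
  have := Limits.preservesFilteredColimitsOfSize_shrink.{0, u, 0, u} (forget (ModuleCat.{u} R))
  obtain ⟨k, f, g, hfg⟩ := Limits.Concrete.isColimit_exists_of_rep_eq _ hc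
    (i := op (op n)) (j := op (op n)) x 0 (hx.trans (map_zero (ofExt 𝔞 i M n).hom).symm)
  refine ⟨k.unop.unop, f.unop.unop.down.down, hfg.trans ?_⟩
  exact map_zero ((F.map g).app M).hom

variable [IsNoetherianRing R]

lemma ofExt_injective {n : ℕ} (h : ∀ j < i, Subsingleton
      (((Ext R (ModuleCat.{u} R) j).obj (op (ModuleCat.of R (R ⧸ 𝔞 ^ n)))).obj M))
    (hn : n ≠ 0) :
    Function.Injective (ofExt 𝔞 i M n).hom := by
  let P (k : ℕ) := projectiveResolution (ModuleCat.of R (R ⧸ 𝔞 ^ k))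
  have h' (j : ℕ) (hj : j < i) :
      Subsingleton (Abelian.Ext (ModuleCat.of R (R ⧸ 𝔞 ^ n)) M j) :=
    have := h j hj
    ((P n).extLinearEquiv M j).symm.toEquiv.subsingleton
  refine (injective_iff_map_eq_zero _).2 fun x hx ↦ ?_
  obtain ⟨k, hk, hkx⟩ := exists_map_eq_zero_of_ofExt_eq_zero 𝔞 i M n x hx
  refine (map_eq_zero_iff _ ((P n).extLinearEquiv M i).injective).1
    (ModuleCat.eq_zero_of_mk₀_factor_comp_eq_zero M h' k ?_ (quotientPowMap 𝔞 hk)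
      (quotientPowMap_surjective 𝔞 hk) _ ?_)
  · rw [← pow_mul]
    exact Ideal.pow_le_pow_right (Nat.le_mul_of_pos_left k (Nat.pos_of_ne_zero hn))
  · rw [← ProjectiveResolution.extLinearEquiv_naturality (P n) (P k), hkx, map_zero]

end localCohomology

lemma IsLocalRing.exists_ne_zero_forall_smul_eq_zero {R : Type*} [CommRing R] [IsLocalRing R]
    (E : Type*) [AddCommGroup E] [Module R E] [Nontrivial E] [IsArtinian R E] :
    ∃ y : E, y ≠ 0 ∧ ∀ c ∈ maximalIdeal R, c • y = 0 := by
  obtain ⟨S, hS⟩ := IsAtomic.exists_atom (Submodule R E)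
  have : IsSimpleModule R S := isSimpleModule_iff_isAtom.2 hS
  have := IsSimpleModule.nontrivial R S
  obtain ⟨y, hy⟩ := exists_ne (0 : S)
  refine ⟨y, by simpa using hy, fun c hc ↦ ?_⟩
  rw [← eq_maximalIdeal (IsSimpleModule.annihilator_isMaximal (R := R) (M := S))] at hc
  exact congrArg Subtype.val (Module.mem_annihilator.1 hc y)

theorem grade_lt_depth_not_artinian
    {R : Type u} [CommRing R] [IsNoetherianRing R] [IsLocalRing R]
    (𝔞 : Ideal R) (M : Type u) [AddCommGroup M] [Module R M] (r : ℕ)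
    (h_grade_mem : Nontrivial
      (((Ext R (ModuleCat.{u} R) r).obj (op (ModuleCat.of R (R ⧸ 𝔞)))).obj (ModuleCat.of R M)))
    (h_grade_min : ∀ i < r, Subsingleton
      (((Ext R (ModuleCat.{u} R) i).obj (op (ModuleCat.of R (R ⧸ 𝔞)))).obj (ModuleCat.of R M)))
    (h_lt_depth : ∀ i ≤ r, Subsingleton
      (((Ext R (ModuleCat.{u} R) i).obj
        (op (ModuleCat.of R (R ⧸ IsLocalRing.maximalIdeal R)))).obj (ModuleCat.of R M))) :
    ¬ IsArtinian R ((localCohomology 𝔞 r).obj (ModuleCat.of R M)) := by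
  intro hart
  have hle : 𝔞 ^ 1 ≤ IsLocalRing.maximalIdeal R := by
    rw [pow_one]
    refine IsLocalRing.le_maximalIdeal fun htop ↦ ?_
    have : Subsingleton (R ⧸ 𝔞) := Ideal.Quotient.subsingleton_iff.2 htop
    have := ModuleCat.subsingleton_ext_of_subsingleton (N := R ⧸ 𝔞) (ModuleCat.of R M) r
    exact not_subsingleton _ ((projectiveResolution (ModuleCat.of R (R ⧸ 𝔞))).extLinearEquiv
      (ModuleCat.of R M) r).toEquiv.subsingleton
  rw [← pow_one 𝔞] at h_grade_mem
  have h_min : ∀ i < r, Subsingleton (((Ext R (ModuleCat.{u} R) i).obj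
      (op (ModuleCat.of R (R ⧸ 𝔞 ^ 1)))).obj (ModuleCat.of R M)) := by
    rwa [pow_one]
  have := isArtinian_of_injective _
    (localCohomology.ofExt_injective 𝔞 r (ModuleCat.of R M) h_min one_ne_zero)
  obtain ⟨y, hy0, hy⟩ := IsLocalRing.exists_ne_zero_forall_smul_eq_zero (R := R)
    (((Ext R (ModuleCat.{u} R) r).obj (op (ModuleCat.of R (R ⧸ 𝔞 ^ 1)))).obj (ModuleCat.of R M))
  let e (J : Ideal R) (i : ℕ) := (projectiveResolution (ModuleCat.of R (R ⧸ J))).extLinearEquiv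
    (ModuleCat.of R M) i
  refine hy0 ((map_eq_zero_iff _ (e (𝔞 ^ 1) r).injective).1
    (ModuleCat.ext_eq_zero_of_smul_eq_zero _ hle (fun i hi ↦ ?_) ?_ _ fun c hc ↦ ?_))
  · have := h_min i hi
    exact (e _ i).symm.toEquiv.subsingleton
  · have := h_lt_depth r le_rfl
    exact (e _ r).symm.toEquiv.subsingleton
  · rw [← map_smul, hy c hc, map_zero]
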